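/- arXiv:2001.02022 — 3 statements merged into one kernel-verified Lean document; each statement's English description precedes it below -/
import Mathlib

section
/- For every integer k with 0 ≤ k ≤ n, the Fenchel conjugate of j_k is given by j_k*(ξ) = inf{ ∫ j* dν : ν a Borel probability measure on Sym_n with support contained in G_k, with finite first moment and barycenter [ν] = ∫ s dν(s) equal to ξ }. -/
open MeasureTheory

noncomputable section

/-- The trace (Frobenius) inner product `z·ξ = trace(zξ)` on symmetric matrices. -/
def mdot {n : ℕ} (z ξ : Matrix (Fin n) (Fin n) ℝ) : ℝ := Matrix.trace (z * ξ)

/-- Fenchel conjugate of a function on the space of real symmetric `n×n` matrices: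
`f*(ξ) = sup { z·ξ - f z : z ∈ Sym_n }`. -/
def fstar {n : ℕ} (f : Matrix (Fin n) (Fin n) ℝ → ℝ) (ξ : Matrix (Fin n) (Fin n) ℝ) : ℝ :=
  sSup { r : ℝ | ∃ z : Matrix (Fin n) (Fin n) ℝ, z.IsSymm ∧ r = mdot z ξ - f z }

/-- `j_k(z) = sup { z·ξ - j*(ξ) : ξ ∈ G_k }`, where `G_k` is the set of symmetric
matrices of rank at most `k`. -/
def jk {n : ℕ} (j : Matrix (Fin n) (Fin n) ℝ → ℝ) (k : ℕ) (z : Matrix (Fin n) (Fin n) ℝ) : ℝ :=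
  sSup { r : ℝ | ∃ ξ : Matrix (Fin n) (Fin n) ℝ, ξ.IsSymm ∧ ξ.rank ≤ k ∧
    r = mdot z ξ - fstar j ξ }

instance matMeasurableSpace (n : ℕ) : MeasurableSpace (Matrix (Fin n) (Fin n) ℝ) :=
  (inferInstance : MeasurableSpace (Fin n → Fin n → ℝ))

/-- A measure on the space of `n×n` real matrices has finite first moment if each entry
is integrable. -/
def FiniteFirstMoment {n : ℕ} (ν : Measure (Matrix (Fin n) (Fin n) ℝ)) : Prop :=
  ∀ i j : Fin n, Integrable (fun s : Matrix (Fin n) (Fin n) ℝ => s i j) ν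

/-- The barycenter `[ν] = ∫ s dν(s)` of a measure on matrices, computed entrywise. -/
def bary {n : ℕ} (ν : Measure (Matrix (Fin n) (Fin n) ℝ)) : Matrix (Fin n) (Fin n) ℝ :=
  Matrix.of fun i j => ∫ s, s i j ∂ν

/-- The set of values `∫ j* dν` over Borel probability measures `ν` on `Sym_n` supported
in `G_k` (symmetric matrices of rank ≤ k), with finite first moment and barycenter `ξ`. -/
def gkSet {n : ℕ} (j : Matrix (Fin n) (Fin n) ℝ → ℝ) (k : ℕ)
    (ξ : Matrix (Fin n) (Fin n) ℝ) : Set ℝ :=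
  { r : ℝ | ∃ ν : Measure (Matrix (Fin n) (Fin n) ℝ), IsProbabilityMeasure ν ∧
      ν {s : Matrix (Fin n) (Fin n) ℝ | ¬ (s.IsSymm ∧ s.rank ≤ k)} = 0 ∧
      FiniteFirstMoment ν ∧ bary ν = ξ ∧
      Integrable (fstar j) ν ∧ r = ∫ s, fstar j s ∂ν }

/-- `g_k(ξ) = inf { ∫ j* dν : ν probability on Sym_n, spt ν ⊆ G_k, [ν] = ξ }`. -/
def gk {n : ℕ} (j : Matrix (Fin n) (Fin n) ℝ → ℝ) (k : ℕ)
    (ξ : Matrix (Fin n) (Fin n) ℝ) : ℝ :=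
  sInf (gkSet j k ξ)

instance matMeasurableSingletonClass (n : ℕ) :
    MeasurableSingletonClass (Matrix (Fin n) (Fin n) ℝ) :=
  (inferInstance : MeasurableSingletonClass (Fin n → Fin n → ℝ))

attribute [local instance] Matrix.normedAddCommGroup Matrix.normedSpace

/-- A convex function on a finite-dimensional space lies above an affine function passing through
any prescribed point strictly below its graph. -/
theorem ConvexOn.exists_affine_le_univ {E : Type*} [NormedAddCommGroup E] [NormedSpace ℝ E]
    [FiniteDimensional ℝ E] {φ : E → ℝ} (hφ : ConvexOn ℝ Set.univ φ) {x : E} {a : ℝ}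
    (ha : a < φ x) :
    ∃ (l : E →ₗ[ℝ] ℝ) (c : ℝ), (∀ y, l y + c ≤ φ y) ∧ l x + c = a := by
  obtain ⟨l, c, hl, hx⟩ := hφ.exists_affine_le_of_lt (𝕜 := ℝ) (Set.mem_univ x) ha isClosed_univ
    (hφ.continuousOn isOpen_univ).lowerSemicontinuousOn
  exact ⟨l, c, fun y => by simpa using hl ⟨y, Set.mem_univ y⟩, by simpa using hx⟩

/-- A linear functional is bounded above relative to a positive definite quadratic form. -/
theorem QuadraticMap.exists_linear_sub_le {E : Type*} [AddCommGroup E] [Module ℝ E]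
    [FiniteDimensional ℝ E] (Q : QuadraticForm ℝ E) (hQ : ∀ z, z ≠ 0 → 0 < Q z)
    (l : E →ₗ[ℝ] ℝ) : ∃ C : ℝ, ∀ z, l z - Q z ≤ C := by
  have hinj : Function.Injective (Q.polarBilin : E →ₗ[ℝ] Module.Dual ℝ E) := by
    rw [injective_iff_map_eq_zero]
    intro z hz
    by_contra hne
    have h := LinearMap.congr_fun hz z
    have hp := hQ z hne
    simp [QuadraticMap.polar_self] at h
    exact hp.ne' h
  obtain ⟨w, hw⟩ := (LinearMap.injective_iff_surjective_of_finrank_eq_finrank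
    (Subspace.dual_finrank_eq (K := ℝ) (V := E)).symm).1 hinj l
  refine ⟨Q w, fun z => ?_⟩
  have h1 : l z = Q (w + z) - Q w - Q z := by rw [← hw]; rfl
  have h2 : 0 ≤ Q (z - w) := by
    rcases eq_or_ne (z - w) 0 with h | h
    · simp [h]
    · exact (hQ _ h).le
  have h3 := QuadraticMap.polar_neg_right (Q := Q) (x := z) (y := w)
  simp only [QuadraticMap.polar, QuadraticMap.map_neg, ← sub_eq_add_neg, add_comm z w] at h3
  linarith

/-- The subspace of symmetric matrices. -/
def symmMatrices (n : ℕ) : Submodule ℝ (Matrix (Fin n) (Fin n) ℝ) where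
  carrier := {z | z.IsSymm}
  add_mem' ha hb := ha.add hb
  zero_mem' := Matrix.isSymm_zero
  smul_mem' c _ h := h.smul c

/-- The linear projection onto symmetric matrices. -/
def symmPart (n : ℕ) : Matrix (Fin n) (Fin n) ℝ →ₗ[ℝ] Matrix (Fin n) (Fin n) ℝ :=
  (1 / 2 : ℝ) • (LinearMap.id + (Matrix.transposeLinearEquiv (Fin n) (Fin n) ℝ ℝ).toLinearMap)

theorem symmPart_apply {n : ℕ} (x : Matrix (Fin n) (Fin n) ℝ) :
    symmPart n x = (1 / 2 : ℝ) • (x + x.transpose) := rfl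

theorem isSymm_symmPart {n : ℕ} (x : Matrix (Fin n) (Fin n) ℝ) : (symmPart n x).IsSymm := by
  rw [symmPart_apply]
  exact Matrix.IsSymm.smul (by simp [Matrix.IsSymm, add_comm]) _

theorem symmPart_of_isSymm {n : ℕ} {x : Matrix (Fin n) (Fin n) ℝ} (hx : x.IsSymm) :
    symmPart n x = x := by
  rw [symmPart_apply, hx.eq, ← two_smul ℝ x, smul_smul]
  norm_num

theorem mdot_eq_sum {n : ℕ} (z x : Matrix (Fin n) (Fin n) ℝ) :
    mdot z x = ∑ a, ∑ b, z a b * x b a := rfl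

theorem mdot_symmPart {n : ℕ} (z : Matrix (Fin n) (Fin n) ℝ) {x : Matrix (Fin n) (Fin n) ℝ}
    (hx : x.IsSymm) : mdot (symmPart n z) x = mdot z x := by
  have h : Matrix.trace (z.transpose * x) = Matrix.trace (z * x) := by
    rw [← Matrix.trace_transpose, Matrix.transpose_mul, Matrix.transpose_transpose, hx.eq,
      Matrix.trace_mul_comm]
  simp only [mdot, symmPart_apply, smul_mul_assoc, add_mul, Matrix.trace_smul, Matrix.trace_add, h,
    smul_eq_mul]
  ring

theorem exists_eq_mdot {n : ℕ} (l : Matrix (Fin n) (Fin n) ℝ →ₗ[ℝ] ℝ) :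
    ∃ z : Matrix (Fin n) (Fin n) ℝ, ∀ x, l x = mdot z x := by
  refine ⟨Matrix.of fun a b => l (Matrix.single b a 1), fun x => ?_⟩
  conv_lhs => rw [Matrix.matrix_eq_sum_single x]
  rw [mdot_eq_sum, Finset.sum_comm]
  simp only [map_sum]
  refine Finset.sum_congr rfl fun a _ => Finset.sum_congr rfl fun b _ => ?_
  have : Matrix.single b a (x b a) = x b a • Matrix.single b a (1 : ℝ) := by simp
  rw [this, map_smul, smul_eq_mul, mul_comm]
  rfl

theorem bddAbove_fstar {n : ℕ} {j : Matrix (Fin n) (Fin n) ℝ → ℝ}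
    (hquad : ∃ Q : QuadraticForm ℝ (Matrix (Fin n) (Fin n) ℝ),
      ∀ z : Matrix (Fin n) (Fin n) ℝ, z.IsSymm → j z = Q z)
    (hpos : ∀ z : Matrix (Fin n) (Fin n) ℝ, z.IsSymm → z ≠ 0 → 0 < j z)
    (ξ : Matrix (Fin n) (Fin n) ℝ) :
    BddAbove { r : ℝ | ∃ z : Matrix (Fin n) (Fin n) ℝ, z.IsSymm ∧ r = mdot z ξ - j z } := by
  obtain ⟨Q, hQ⟩ := hquad
  obtain ⟨C, hC⟩ := (Q.comp (symmMatrices n).subtype).exists_linear_sub_le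
    (fun z hz => by
      have := hpos z.1 z.2 (by simpa using hz)
      rwa [hQ z.1 z.2] at this)
    ((Matrix.traceLinearMap (Fin n) ℝ ℝ ∘ₗ LinearMap.mulRight ℝ ξ) ∘ₗ (symmMatrices n).subtype)
  refine ⟨C, ?_⟩
  rintro _ ⟨z, hz, rfl⟩
  rw [hQ z hz]
  exact hC ⟨z, hz⟩

theorem sub_le_fstar {n : ℕ} {f : Matrix (Fin n) (Fin n) ℝ → ℝ} {z ξ : Matrix (Fin n) (Fin n) ℝ}
    (hb : BddAbove { r : ℝ | ∃ z : Matrix (Fin n) (Fin n) ℝ, z.IsSymm ∧ r = mdot z ξ - f z })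
    (hz : z.IsSymm) : mdot z ξ - f z ≤ fstar f ξ :=
  le_csSup hb ⟨z, hz, rfl⟩

section

variable {n : ℕ} {j : Matrix (Fin n) (Fin n) ℝ → ℝ} {k : ℕ}

theorem fstar_nonneg
    (hb : ∀ ξ, BddAbove
      { r : ℝ | ∃ z : Matrix (Fin n) (Fin n) ℝ, z.IsSymm ∧ r = mdot z ξ - j z })
    (h0 : j 0 = 0) (ξ : Matrix (Fin n) (Fin n) ℝ) : 0 ≤ fstar j ξ := by
  have := sub_le_fstar (hb ξ) Matrix.isSymm_zero
  simpa [mdot, h0] using this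

theorem sub_fstar_le_jk
    (hb : ∀ ξ, BddAbove
      { r : ℝ | ∃ z : Matrix (Fin n) (Fin n) ℝ, z.IsSymm ∧ r = mdot z ξ - j z })
    {z s : Matrix (Fin n) (Fin n) ℝ} (hz : z.IsSymm) (hs : s.IsSymm) (hk : s.rank ≤ k) :
    mdot z s - fstar j s ≤ jk j k z := by
  refine le_csSup ⟨j z, ?_⟩ ⟨s, hs, hk, rfl⟩
  rintro _ ⟨t, -, -, rfl⟩
  linarith [sub_le_fstar (hb t) hz]

theorem integrable_mdot (z : Matrix (Fin n) (Fin n) ℝ)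
    {ν : Measure (Matrix (Fin n) (Fin n) ℝ)} (hν : FiniteFirstMoment ν) :
    Integrable (fun s => mdot z s) ν := by
  simp only [mdot_eq_sum]
  exact integrable_finsetSum _ fun a _ => integrable_finsetSum _ fun b _ =>
    (hν b a).const_mul _

theorem mdot_bary (z : Matrix (Fin n) (Fin n) ℝ)
    {ν : Measure (Matrix (Fin n) (Fin n) ℝ)} (hν : FiniteFirstMoment ν) :
    mdot z (bary ν) = ∫ s, mdot z s ∂ν := by
  simp only [mdot_eq_sum]
  symm
  refine (integral_finsetSum _ fun a _ => integrable_finsetSum _ fun b _ =>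
    (hν b a).const_mul _).trans (Finset.sum_congr rfl fun a _ => ?_)
  refine (integral_finsetSum _ fun b _ => (hν b a).const_mul _).trans
    (Finset.sum_congr rfl fun b _ => ?_)
  exact integral_const_mul _ _

/-- Weak duality between `j_k` and measures supported in `G_k`. -/
theorem sub_jk_le_of_mem_gkSet
    (hb : ∀ ξ, BddAbove
      { r : ℝ | ∃ z : Matrix (Fin n) (Fin n) ℝ, z.IsSymm ∧ r = mdot z ξ - j z })
    {z ξ : Matrix (Fin n) (Fin n) ℝ} (hz : z.IsSymm) {r : ℝ} (hr : r ∈ gkSet j k ξ) :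
    mdot z ξ - jk j k z ≤ r := by
  obtain ⟨ν, hν, hsupp, hmom, rfl, hint, rfl⟩ := hr
  have hae : ∀ᵐ s ∂ν, s.IsSymm ∧ s.rank ≤ k := hsupp
  have h : ∫ s, (mdot z s - jk j k z) ∂ν ≤ ∫ s, fstar j s ∂ν := by
    refine integral_mono_ae ((integrable_mdot z hmom).sub (integrable_const _)) hint ?_
    filter_upwards [hae] with s hs
    linarith [sub_fstar_le_jk hb hz hs.1 hs.2]
  rwa [integral_sub (integrable_mdot z hmom) (integrable_const _), ← mdot_bary z hmom,
    integral_const, probReal_univ, one_smul] at h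

theorem fstar_mem_gkSet {s : Matrix (Fin n) (Fin n) ℝ} (hs : s.IsSymm) (hk : s.rank ≤ k) :
    fstar j s ∈ gkSet j k s := by
  refine ⟨Measure.dirac s, inferInstance, ?_, fun a b => integrable_dirac (by simp), ?_,
    integrable_dirac (by simp), (integral_dirac _ _).symm⟩
  · have : ∀ᵐ t ∂Measure.dirac s, t.IsSymm ∧ t.rank ≤ k := by
      rw [ae_dirac_eq]
      exact ⟨hs, hk⟩
    exact this
  · ext a b
    simp [bary, integral_dirac]

theorem nonneg_of_mem_gkSet (hf : ∀ ξ, 0 ≤ fstar j ξ) {ξ : Matrix (Fin n) (Fin n) ℝ} {r : ℝ}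
    (hr : r ∈ gkSet j k ξ) : 0 ≤ r := by
  obtain ⟨ν, -, -, -, -, -, rfl⟩ := hr
  exact integral_nonneg hf

theorem add_mem_gkSet {x y : Matrix (Fin n) (Fin n) ℝ} {r t a b : ℝ}
    (hr : r ∈ gkSet j k x) (ht : t ∈ gkSet j k y) (ha : 0 ≤ a) (hb : 0 ≤ b) (hab : a + b = 1) :
    a * r + b * t ∈ gkSet j k (a • x + b • y) := by
  obtain ⟨μ, hμ, hμs, hμm, rfl, hμi, rfl⟩ := hr
  obtain ⟨ν, hν, hνs, hνm, rfl, hνi, rfl⟩ := ht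
  have key (f : Matrix (Fin n) (Fin n) ℝ → ℝ) (hfμ : Integrable f μ) (hfν : Integrable f ν) :
      ∫ s, f s ∂(ENNReal.ofReal a • μ + ENNReal.ofReal b • ν) =
        a * ∫ s, f s ∂μ + b * ∫ s, f s ∂ν := by
    rw [integral_add_measure (hfμ.smul_measure ENNReal.ofReal_ne_top)
      (hfν.smul_measure ENNReal.ofReal_ne_top), integral_smul_measure, integral_smul_measure,
      ENNReal.toReal_ofReal ha, ENNReal.toReal_ofReal hb, smul_eq_mul, smul_eq_mul]
  have keyi (f : Matrix (Fin n) (Fin n) ℝ → ℝ) (hfμ : Integrable f μ) (hfν : Integrable f ν) :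
      Integrable f (ENNReal.ofReal a • μ + ENNReal.ofReal b • ν) :=
    (hfμ.smul_measure ENNReal.ofReal_ne_top).add_measure
      (hfν.smul_measure ENNReal.ofReal_ne_top)
  refine ⟨ENNReal.ofReal a • μ + ENNReal.ofReal b • ν, ⟨?_⟩, ?_,
    fun p q => keyi _ (hμm p q) (hνm p q), ?_, keyi _ hμi hνi, (key _ hμi hνi).symm⟩
  · simp [← ENNReal.ofReal_add ha hb, hab]
  · rw [Measure.add_apply, Measure.smul_apply, Measure.smul_apply, hμs, hνs]
    simp
  · ext p q
    exact key _ (hμm p q) (hνm p q)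

/-- The points which are barycenters of admissible measures form a convex set. -/
theorem convex_nonempty_gkSet :
    Convex ℝ {x : Matrix (Fin n) (Fin n) ℝ | (gkSet j k x).Nonempty} := by
  rintro x ⟨r, hr⟩ y ⟨t, ht⟩ a b ha hb hab
  exact ⟨_, add_mem_gkSet hr ht ha hb hab⟩

/-- Every symmetric matrix is an average of symmetric matrices of rank at most one. -/
theorem gkSet_nonempty (hn : 1 ≤ n) (hk : 1 ≤ k) {ξ : Matrix (Fin n) (Fin n) ℝ} (hξ : ξ.IsSymm) :
    (gkSet j k ξ).Nonempty := by
  have hH : ξ.IsHermitian := by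
    rw [Matrix.IsHermitian, Matrix.conjTranspose_eq_transpose_of_trivial]
    exact hξ
  let U : Matrix (Fin n) (Fin n) ℝ := hH.eigenvectorUnitary
  have hn0 : (n : ℝ) ≠ 0 := by positivity
  have hsum : ξ = ∑ i : Fin n, (1 / n : ℝ) •
      (U * Matrix.diagonal (Pi.single i (n * hH.eigenvalues i)) * U.transpose) := by
    have hdiag : Matrix.diagonal hH.eigenvalues =
        ∑ i : Fin n, (1 / n : ℝ) • Matrix.diagonal (Pi.single i (n * hH.eigenvalues i)) := by
      ext a b
      rw [Matrix.sum_apply]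
      by_cases hab : a = b
      · subst hab
        simp [Pi.single_apply, hn0]
      · simp [hab]
    have h := hH.spectral_theorem
    rw [Unitary.conjStarAlgAut_apply] at h
    calc ξ = U * Matrix.diagonal hH.eigenvalues * U.transpose := h
      _ = _ := by
        rw [hdiag, Finset.mul_sum, Finset.sum_mul]
        simp
  rw [hsum]
  refine convex_nonempty_gkSet.sum_mem (fun _ _ => by positivity) (by simp [hn0])
    fun i _ => ⟨_, fstar_mem_gkSet ?_ ?_⟩
  · simp [Matrix.IsSymm, Matrix.transpose_mul, mul_assoc]
  · refine (Matrix.rank_mul_le_left _ _).trans ((Matrix.rank_mul_le_right _ _).trans ?_)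
    rw [Matrix.rank_diagonal]
    refine le_trans ?_ hk
    rw [Fintype.card_le_one_iff_subsingleton]
    refine ⟨fun a b => Subtype.ext ?_⟩
    have h (c : {m // Pi.single (M := fun _ => ℝ) i (n * hH.eigenvalues i) m ≠ 0}) :
        (c : Fin n) = i := by
      by_contra hc
      exact c.2 (Pi.single_eq_of_ne hc _)
    rw [h a, h b]

theorem convexOn_gk_symmPart (hf : ∀ ξ, 0 ≤ fstar j ξ) (hn : 1 ≤ n) (hk : 1 ≤ k) :
    ConvexOn ℝ Set.univ fun x => gk j k (symmPart n x) := by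
  refine ⟨convex_univ, fun x _ y _ a b ha hb hab => ?_⟩
  refine le_of_forall_pos_le_add fun ε hε => ?_
  obtain ⟨r, hr, hr'⟩ := Real.lt_sInf_add_pos
    (gkSet_nonempty (j := j) hn hk (isSymm_symmPart x)) hε
  obtain ⟨t, ht, ht'⟩ := Real.lt_sInf_add_pos
    (gkSet_nonempty (j := j) hn hk (isSymm_symmPart y)) hε
  have hmem := add_mem_gkSet hr ht ha hb hab
  have hle : gk j k (symmPart n (a • x + b • y)) ≤ a * r + b * t := by
    rw [map_add, map_smul, map_smul]
    exact csInf_le ⟨0, fun _ h => nonneg_of_mem_gkSet hf h⟩ hmem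
  refine hle.trans ?_
  change r < gk j k (symmPart n x) + ε at hr'
  change t < gk j k (symmPart n y) + ε at ht'
  simp only [smul_eq_mul]
  calc a * r + b * t ≤ a * (gk j k (symmPart n x) + ε) + b * (gk j k (symmPart n y) + ε) := by
        gcongr
    _ = a * gk j k (symmPart n x) + b * gk j k (symmPart n y) + (a + b) * ε := by ring
    _ = _ := by rw [hab, one_mul]

theorem fstar_jk_le_gk
    (hb : ∀ ξ, BddAbove
      { r : ℝ | ∃ z : Matrix (Fin n) (Fin n) ℝ, z.IsSymm ∧ r = mdot z ξ - j z })
    {ξ : Matrix (Fin n) (Fin n) ℝ} (hne : (gkSet j k ξ).Nonempty) :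
    fstar (jk j k) ξ ≤ gk j k ξ := by
  refine csSup_le ⟨_, 0, Matrix.isSymm_zero, rfl⟩ ?_
  rintro _ ⟨z, hz, rfl⟩
  exact le_csInf hne fun r hr => sub_jk_le_of_mem_gkSet hb hz hr

theorem bddAbove_sub_jk
    (hb : ∀ ξ, BddAbove
      { r : ℝ | ∃ z : Matrix (Fin n) (Fin n) ℝ, z.IsSymm ∧ r = mdot z ξ - j z })
    {ξ : Matrix (Fin n) (Fin n) ℝ} (hne : (gkSet j k ξ).Nonempty) :
    BddAbove { r : ℝ | ∃ z : Matrix (Fin n) (Fin n) ℝ, z.IsSymm ∧ r = mdot z ξ - jk j k z } := by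
  obtain ⟨r, hr⟩ := hne
  refine ⟨r, ?_⟩
  rintro _ ⟨z, hz, rfl⟩
  exact sub_jk_le_of_mem_gkSet hb hz hr

/-- Strong duality for positive rank bounds, by supporting the convex function `g_k` from below. -/
theorem gk_le_fstar_jk
    (hb : ∀ ξ, BddAbove
      { r : ℝ | ∃ z : Matrix (Fin n) (Fin n) ℝ, z.IsSymm ∧ r = mdot z ξ - j z })
    (hf : ∀ ξ, 0 ≤ fstar j ξ) (hn : 1 ≤ n) (hk : 1 ≤ k)
    {ξ : Matrix (Fin n) (Fin n) ℝ} (hξ : ξ.IsSymm) :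
    gk j k ξ ≤ fstar (jk j k) ξ := by
  refine le_of_forall_lt_imp_le_of_dense fun a ha => ?_
  obtain ⟨l, c, hle, heq⟩ := (convexOn_gk_symmPart hf hn hk).exists_affine_le_univ (x := ξ) (a := a)
    (by simpa only [symmPart_of_isSymm hξ] using ha)
  obtain ⟨z, hz⟩ := exists_eq_mdot l
  have hjk : jk j k (symmPart n z) ≤ -c := by
    refine csSup_le ⟨_, 0, Matrix.isSymm_zero, by simp, rfl⟩ ?_
    rintro _ ⟨s, hs, hsk, rfl⟩
    have h1 := hle s
    rw [hz, symmPart_of_isSymm hs] at h1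
    have h2 : gk j k s ≤ fstar j s :=
      csInf_le ⟨0, fun _ h => nonneg_of_mem_gkSet hf h⟩ (fstar_mem_gkSet hs hsk)
    rw [mdot_symmPart z hs]
    linarith
  have h := sub_le_fstar (bddAbove_sub_jk hb (gkSet_nonempty hn hk hξ)) (isSymm_symmPart z)
  rw [mdot_symmPart z hξ, ← hz] at h
  linarith

theorem Matrix.eq_zero_of_rank_le_zero {A : Matrix (Fin n) (Fin n) ℝ} (h : A.rank ≤ 0) :
    A = 0 := by
  have h' : LinearMap.range A.mulVecLin = ⊥ := Submodule.finrank_eq_zero.1 (Nat.le_zero.1 h)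
  refine (Matrix.toLin' (R := ℝ) (m := Fin n) (n := Fin n)).injective ?_
  rw [map_zero]
  exact LinearMap.range_eq_bot.1 h'

theorem jk_zero (h : fstar j 0 = 0) (z : Matrix (Fin n) (Fin n) ℝ) : jk j 0 z = 0 := by
  have : { r : ℝ | ∃ ξ : Matrix (Fin n) (Fin n) ℝ, ξ.IsSymm ∧ ξ.rank ≤ 0 ∧
      r = mdot z ξ - fstar j ξ } = {0} := by
    ext r
    constructor
    · rintro ⟨ξ, -, hr, rfl⟩
      obtain rfl : ξ = 0 := Matrix.eq_zero_of_rank_le_zero hr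
      simp [mdot, h]
    · rintro rfl
      exact ⟨0, Matrix.isSymm_zero, by simp, by simp [mdot, h]⟩
  rw [jk, this, csSup_singleton]

theorem gkSet_zero_eq_empty {ξ : Matrix (Fin n) (Fin n) ℝ} (hξ : ξ ≠ 0) : gkSet j 0 ξ = ∅ := by
  rw [Set.eq_empty_iff_forall_notMem]
  rintro _ ⟨ν, -, hsupp, -, rfl, -, -⟩
  refine hξ ?_
  have hae : ∀ᵐ s ∂ν, s.IsSymm ∧ s.rank ≤ 0 := hsupp
  ext a b
  refine integral_eq_zero_of_ae ?_
  filter_upwards [hae] with s hs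
  rw [Matrix.eq_zero_of_rank_le_zero hs.2]
  rfl

theorem fstar_zero_fun_of_ne {ξ : Matrix (Fin n) (Fin n) ℝ} (hs : ξ.IsSymm) (hξ : ξ ≠ 0) :
    fstar (fun _ => 0) ξ = 0 := by
  refine Real.sSup_of_not_bddAbove ?_
  rintro ⟨C, hC⟩
  have hpos : 0 < mdot ξ ξ := by
    have h0 : 0 ≤ mdot ξ ξ := by
      rw [mdot_eq_sum]
      exact Finset.sum_nonneg fun a _ => Finset.sum_nonneg fun b _ => by
        rw [hs.apply a b]; exact mul_self_nonneg _
    refine h0.lt_of_ne' fun h => hξ ?_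
    apply Matrix.trace_conjTranspose_mul_self_eq_zero_iff.1
    rwa [Matrix.conjTranspose_eq_transpose_of_trivial, hs.eq]
  have h := hC ⟨((C + 1) / mdot ξ ξ) • ξ, hs.smul _, rfl⟩
  have h' : mdot (((C + 1) / mdot ξ ξ) • ξ) ξ = C + 1 := by
    rw [mdot, smul_mul_assoc, Matrix.trace_smul, smul_eq_mul]
    exact div_mul_cancel₀ _ hpos.ne'
  linarith

end

/-- for every `0 ≤ k ≤ n`, the Fenchel conjugate of `j_k` is
`j_k*(ξ) = inf { ∫ j* dν : ν probability on Sym_n supported in G_k, finite first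
moment, barycenter ξ }`. -/
theorem jkstar_eq_inf_integrals (n : ℕ) (hn : 1 ≤ n) (j : Matrix (Fin n) (Fin n) ℝ → ℝ)
    (hquad : ∃ Q : QuadraticForm ℝ (Matrix (Fin n) (Fin n) ℝ),
      ∀ z : Matrix (Fin n) (Fin n) ℝ, z.IsSymm → j z = Q z)
    (hpos : ∀ z : Matrix (Fin n) (Fin n) ℝ, z.IsSymm → z ≠ 0 → 0 < j z)
    (k : ℕ) (hk : k ≤ n) :
    ∀ ξ : Matrix (Fin n) (Fin n) ℝ, ξ.IsSymm →
      fstar (jk j k) ξ = gk j k ξ := by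
  intro ξ hξ
  have hb := bddAbove_fstar hquad hpos
  have h0 : j 0 = 0 := by
    obtain ⟨Q, hQ⟩ := hquad
    rw [hQ 0 Matrix.isSymm_zero, QuadraticMap.map_zero]
  have hf := fstar_nonneg hb h0
  rcases Nat.eq_zero_or_pos k with rfl | hk'
  · have hf0 : fstar j 0 = 0 := by
      refine le_antisymm (csSup_le ⟨_, 0, Matrix.isSymm_zero, rfl⟩ ?_) (hf 0)
      rintro _ ⟨z, hz, rfl⟩
      rcases eq_or_ne z 0 with rfl | hne
      · simp [mdot, h0]
      · simpa [mdot] using (hpos z hz hne).le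
    rw [show jk j 0 = fun _ => 0 from funext (jk_zero hf0)]
    rcases eq_or_ne ξ 0 with rfl | hne
    · have hmem : (0 : ℝ) ∈ gkSet j 0 (0 : Matrix (Fin n) (Fin n) ℝ) := by
        have h := fstar_mem_gkSet (j := j) (k := 0) hξ (by simp)
        rwa [hf0] at h
      have hg : gk j 0 (0 : Matrix (Fin n) (Fin n) ℝ) = 0 :=
        IsLeast.csInf_eq ⟨hmem, fun _ h => nonneg_of_mem_gkSet hf h⟩
      rw [hg]
      refine IsGreatest.csSup_eq ⟨⟨0, Matrix.isSymm_zero, by simp [mdot]⟩, ?_⟩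
      rintro _ ⟨z, -, rfl⟩
      simp [mdot]
    · rw [fstar_zero_fun_of_ne hξ hne, gk, gkSet_zero_eq_empty hne, Real.sInf_empty]
  · exact le_antisymm (fstar_jk_le_gk hb (gkSet_nonempty hn hk' hξ))
      (gk_le_fstar_jk hb hf hn hk' hξ)
end
end

section
/- Let n = 2 and let α, β ∈ ℝ satisfy β > 0 and α + β > 0. Define j(z) = (α/2)(tr z)² + β‖z‖² on Sym_2 (Frobenius norm), and set γ = (α + 2β)/(4β(α + β)). Then for every z ∈ Sym_2, \bar j(z) := j_1(z) = (1/(2γ)) λ₁(z)², where λ₁(z), λ₂(z) are the eigenvalues of z ordered so that |λ₁(z)| ≥ |λ₂(z)|. -/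
open MeasureTheory

noncomputable section

/-- The Fenchel conjugate of `(a/2)(tr w)² + b‖w‖²` on symmetric `2×2` matrices. -/
theorem fstar_quadratic_fin_two {a b : ℝ} (hb : 0 < b) (hab : 0 < a + b)
    {ξ : Matrix (Fin 2) (Fin 2) ℝ} (hξ : ξ.IsSymm) :
    fstar (fun w : Matrix (Fin 2) (Fin 2) ℝ =>
        (a / 2) * (Matrix.trace w) ^ 2 + b * ∑ i, ∑ j', (w i j') ^ 2) ξ
      = (∑ i, ∑ j', (ξ i j') ^ 2 - a / (2 * (a + b)) * (Matrix.trace ξ) ^ 2) / (4 * b) := by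
  have h10 : ξ 1 0 = ξ 0 1 := hξ.apply 0 1
  apply IsGreatest.csSup_eq
  constructor
  · refine ⟨(1 / (2 * b)) • (ξ - (a / (2 * (a + b)) * Matrix.trace ξ) • 1), ?_, ?_⟩
    · exact ((hξ.sub (Matrix.isSymm_one.smul _)).smul _)
    · simp only [mdot, Matrix.trace_fin_two, Matrix.mul_apply, Fin.sum_univ_two,
        Matrix.smul_apply, Matrix.sub_apply, Matrix.one_apply, smul_eq_mul, h10]
      simp
      field_simp
      ring
  · rintro _ ⟨w, hw, rfl⟩
    have w10 : w 1 0 = w 0 1 := hw.apply 0 1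
    simp only [mdot, Matrix.trace_fin_two, Matrix.mul_apply, Fin.sum_univ_two, h10, w10]
    set c := a / (2 * (a + b)) * (ξ 0 0 + ξ 1 1) with hc
    set dx := w 0 0 - (ξ 0 0 - c) / (2 * b) with hdx
    set dy := w 0 1 - ξ 0 1 / (2 * b) with hdy
    set du := w 1 1 - (ξ 1 1 - c) / (2 * b) with hdu
    have key : 0 ≤ (a + b) / 2 * (dx + du) ^ 2 + b / 2 * (dx - du) ^ 2 + 2 * b * dy ^ 2 := by
      positivity
    rw [← sub_nonneg]
    refine key.trans_eq ?_
    rw [hdx, hdy, hdu, hc]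
    field_simp
    ring

/-- On singular symmetric `2×2` matrices the conjugate depends only on the trace. -/
theorem fstar_quadratic_of_det_eq_zero {a b : ℝ} (hb : 0 < b) (hab : 0 < a + b)
    {ξ : Matrix (Fin 2) (Fin 2) ℝ} (hξ : ξ.IsSymm) (hdet : ξ.det = 0) :
    fstar (fun w : Matrix (Fin 2) (Fin 2) ℝ =>
        (a / 2) * (Matrix.trace w) ^ 2 + b * ∑ i, ∑ j', (w i j') ^ 2) ξ
      = (a + 2 * b) / (4 * b * (a + b)) / 2 * (Matrix.trace ξ) ^ 2 := by
  have h10 : ξ 1 0 = ξ 0 1 := hξ.apply 0 1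
  rw [fstar_quadratic_fin_two hb hab hξ]
  have hsq : ∑ i, ∑ j', (ξ i j') ^ 2 = (Matrix.trace ξ) ^ 2 := by
    rw [Matrix.det_fin_two] at hdet
    simp only [Matrix.trace_fin_two, Fin.sum_univ_two, h10] at hdet ⊢
    linear_combination -2 * hdet
  rw [hsq]
  field_simp
  ring

theorem det_eq_zero_of_rank_le_one {ξ : Matrix (Fin 2) (Fin 2) ℝ} (h : ξ.rank ≤ 1) :
    ξ.det = 0 := by
  by_contra hne
  have hr := Matrix.rank_of_isUnit ξ ((Matrix.isUnit_iff_isUnit_det ξ).2 (isUnit_iff_ne_zero.2 hne))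
  rw [Fintype.card_fin] at hr
  omega

/-- A singular symmetric `2×2` matrix pairs with `z` to at most the spectral radius of `z`
times the absolute value of the trace. -/
theorem mdot_le_of_det_eq_zero {P ξ : Matrix (Fin 2) (Fin 2) ℝ} {lam : Fin 2 → ℝ}
    (hP : P * P.transpose = 1) (h01 : |lam 1| ≤ |lam 0|) (hξ : ξ.IsSymm) (hdet : ξ.det = 0) :
    mdot (P * Matrix.diagonal lam * P.transpose) ξ ≤ |lam 0| * |Matrix.trace ξ| := by
  set η := P.transpose * ξ * P with hη
  have hdot : mdot (P * Matrix.diagonal lam * P.transpose) ξ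
      = lam 0 * η 0 0 + lam 1 * η 1 1 := by
    rw [mdot, Matrix.mul_assoc, Matrix.mul_assoc, Matrix.trace_mul_comm, Matrix.mul_assoc, ← hη,
      Matrix.trace_fin_two, Matrix.diagonal_mul, Matrix.diagonal_mul]
  have htr : η 0 0 + η 1 1 = Matrix.trace ξ := by
    rw [← Matrix.trace_fin_two, hη, Matrix.trace_mul_comm, ← Matrix.mul_assoc, hP, Matrix.one_mul]
  have hηsymm : η 1 0 = η 0 1 := by
    have : η.IsSymm := by
      simp [Matrix.IsSymm, hη, Matrix.transpose_mul, hξ.eq, Matrix.mul_assoc]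
    exact this.apply 0 1
  have hηdet : η.det = 0 := by simp [hη, hdet]
  have hprod : 0 ≤ η 0 0 * η 1 1 := by
    rw [Matrix.det_fin_two, hηsymm] at hηdet
    nlinarith [sq_nonneg (η 0 1)]
  rw [hdot, ← htr, abs_add_eq_add_abs_iff _ _ |>.2 (mul_nonneg_iff.1 hprod), mul_add]
  refine add_le_add ((le_abs_self _).trans_eq (abs_mul _ _)) ?_
  calc lam 1 * η 1 1 ≤ |lam 1| * |η 1 1| := (le_abs_self _).trans_eq (abs_mul _ _)
    _ ≤ |lam 0| * |η 1 1| := by gcongr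

/-- for `n = 2`, `β > 0`, `α + β > 0`, `j(z) = (α/2)(tr z)² + β‖z‖²`
(Frobenius norm) and `γ = (α + 2β)/(4β(α + β))`, for every symmetric `z` with
eigenvalues `λ 0, λ 1` (given by an orthogonal diagonalization) ordered so that
`|λ 0| ≥ |λ 1|`, one has `\bar j(z) := j_1(z) = (1/(2γ)) λ 0²`. -/
theorem jbar_eq_dim2 (a b : ℝ) (hb : 0 < b) (hab : 0 < a + b)
    (z P : Matrix (Fin 2) (Fin 2) ℝ) (lam : Fin 2 → ℝ)
    (hP : P * P.transpose = 1) (hz : z = P * Matrix.diagonal lam * P.transpose)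
    (h01 : |lam 1| ≤ |lam 0|) :
    jk (fun w : Matrix (Fin 2) (Fin 2) ℝ =>
        (a / 2) * (Matrix.trace w) ^ 2 + b * ∑ i, ∑ j', (w i j') ^ 2) 1 z
      = (1 / (2 * ((a + 2 * b) / (4 * b * (a + b))))) * (lam 0) ^ 2 := by
  set g := (a + 2 * b) / (4 * b * (a + b)) with hg
  have hgpos : 0 < g := div_pos (by linarith) (by positivity)
  apply IsGreatest.csSup_eq
  constructor
  · have hP' : P.transpose * P = 1 := mul_eq_one_comm.1 hP
    set v : Fin 2 → ℝ := fun i => P i 0 with hv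
    have hvv : v ⬝ᵥ v = 1 := by
      have := congrFun (congrFun hP' 0) 0
      simpa [Matrix.mul_apply, dotProduct] using this
    have hzv : z.mulVec v = lam 0 • v := by
      have : z * P = P * Matrix.diagonal lam := by
        rw [hz, Matrix.mul_assoc, hP', Matrix.mul_one]
      ext i
      have := congrFun (congrFun this i) 0
      rw [Matrix.mul_diagonal] at this
      simpa [Matrix.mul_apply, Matrix.mulVec, dotProduct, mul_comm] using this
    have hsymm : (Matrix.vecMulVec ((lam 0 / g) • v) v).IsSymm := by
      ext i k
      simp [Matrix.vecMulVec_apply]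
      ring
    have hrank := Matrix.rank_vecMulVec_le ((lam 0 / g) • v) v
    refine ⟨_, hsymm, hrank, ?_⟩
    rw [fstar_quadratic_of_det_eq_zero hb hab hsymm (det_eq_zero_of_rank_le_one hrank), ← hg,
      mdot, Matrix.mul_vecMulVec, Matrix.mulVec_smul, hzv, Matrix.trace_vecMulVec,
      Matrix.trace_vecMulVec]
    simp only [smul_dotProduct, hvv, smul_eq_mul]
    field_simp
    ring
  · rintro _ ⟨ξ, hξ, hrank, rfl⟩
    have hdet := det_eq_zero_of_rank_le_one hrank
    rw [fstar_quadratic_of_det_eq_zero hb hab hξ hdet, ← hg, hz, ← sq_abs (lam 0),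
      ← sq_abs (Matrix.trace ξ)]
    refine (sub_le_sub_right (mdot_le_of_det_eq_zero hP h01 hξ hdet) _).trans ?_
    rw [← sub_nonneg]
    have key : 0 ≤ (|lam 0| - g * |Matrix.trace ξ|) ^ 2 / (2 * g) := by positivity
    refine key.trans_eq ?_
    field_simp
    ring
end
end

section
/- Let 0 < r < 1/4. There exists an essentially bounded measurable map φ : ℝ² → Sym_2 which is ℤ²-periodic, equals the identity matrix I₂ almost everywhere on the set ⋃_{k∈ℤ²} { y : |y − k| ≤ r }, vanishes almost everywhere on the complement of ⋃_{k∈ℤ²} { y : |y − k| < 2r }, and is divergence-free in the sense of distributions: ∫_{ℝ²} φ(y) · e(ψ)(y) dy = 0 for every ψ ∈ C_c^∞(ℝ²; ℝ²), where e(ψ) is the symmetrized gradient of ψ, e(ψ)_{ij} = (1/2)(∂ψ_i/∂x_j + ∂ψ_j/∂x_i), and · is the Frobenius inner product. -/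
open MeasureTheory

/-- The partial derivative of `f` in the `i`-th coordinate direction. -/
noncomputable def partialDeriv (i : Fin 2) (f : (Fin 2 → ℝ) → ℝ) (y : Fin 2 → ℝ) : ℝ :=
  fderiv ℝ f y (Pi.single i 1)

/-- The integer point obtained by rounding every coordinate. -/
noncomputable def latticeRound (y : Fin 2 → ℝ) : Fin 2 → ℝ := fun i => (round (y i) : ℝ)

/-- The stress field with Airy potential `u`, i.e. the cofactor matrix of the Hessian of `u`. -/
noncomputable def airyStress (u : (Fin 2 → ℝ) → ℝ) (y : Fin 2 → ℝ) : Matrix (Fin 2) (Fin 2) ℝ :=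
  !![partialDeriv 1 (partialDeriv 1 u) y, -partialDeriv 0 (partialDeriv 1 u) y;
    -partialDeriv 0 (partialDeriv 1 u) y, partialDeriv 0 (partialDeriv 0 u) y]

/-- The potential `|y|² / 2` cut off smoothly between the radii `√2 r` and `√3 r`. -/
noncomputable def cutoffPotential (r : ℝ) (y : Fin 2 → ℝ) : ℝ :=
  (y 0 ^ 2 + y 1 ^ 2) / 2 * Real.smoothTransition ((3 * r ^ 2 - (y 0 ^ 2 + y 1 ^ 2)) / r ^ 2)

theorem contDiff_partialDeriv {f : (Fin 2 → ℝ) → ℝ} (hf : ContDiff ℝ (⊤ : ℕ∞) f) (i : Fin 2) :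
    ContDiff ℝ (⊤ : ℕ∞) (partialDeriv i f) :=
  (hf.fderiv_right (m := (⊤ : ℕ∞)) (by norm_cast)).clm_apply contDiff_const

theorem HasCompactSupport.partialDeriv {f : (Fin 2 → ℝ) → ℝ} (hf : HasCompactSupport f)
    (i : Fin 2) : HasCompactSupport (partialDeriv i f) :=
  (hf.fderiv ℝ).comp_left (g := fun L : (Fin 2 → ℝ) →L[ℝ] ℝ => L (Pi.single i 1)) rfl

theorem partialDeriv_congr {f g : (Fin 2 → ℝ) → ℝ} {y : Fin 2 → ℝ} (h : f =ᶠ[nhds y] g)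
    (i : Fin 2) : partialDeriv i f =ᶠ[nhds y] partialDeriv i g :=
  h.fderiv.fun_comp (fun L : (Fin 2 → ℝ) →L[ℝ] ℝ => L (Pi.single i 1))

theorem partialDeriv_comm {f : (Fin 2 → ℝ) → ℝ} (hf : ContDiff ℝ (⊤ : ℕ∞) f) (i j : Fin 2)
    (y : Fin 2 → ℝ) :
    partialDeriv i (partialDeriv j f) y = partialDeriv j (partialDeriv i f) y := by
  have hd : DifferentiableAt ℝ (fderiv ℝ f) y :=
    (hf.fderiv_right (m := (⊤ : ℕ∞)) (by norm_cast)).differentiable (by simp) y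
  have key (a b : Fin 2) : partialDeriv a (partialDeriv b f) y
      = fderiv ℝ (fderiv ℝ f) y (Pi.single a 1) (Pi.single b 1) := by
    have : partialDeriv b f = fun z => fderiv ℝ f z (Pi.single b 1) := rfl
    rw [this, partialDeriv, fderiv_clm_apply hd (differentiableAt_const _)]
    simp
  rw [key, key]
  exact (hf.contDiffAt.isSymmSndFDerivAt (by
    simpa using WithTop.coe_le_coe.2 (le_top : (2 : ℕ∞) ≤ ⊤))).eq _ _

theorem partialDeriv_add_const {f : (Fin 2 → ℝ) → ℝ} {a : Fin 2 → ℝ}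
    (h : ∀ y, f (y + a) = f y) (i : Fin 2) (y : Fin 2 → ℝ) :
    partialDeriv i f (y + a) = partialDeriv i f y := by
  rw [partialDeriv, partialDeriv, ← fderiv_comp_add_right, funext h]

theorem airyStress_congr {f g : (Fin 2 → ℝ) → ℝ} {y : Fin 2 → ℝ} (h : f =ᶠ[nhds y] g) :
    airyStress f y = airyStress g y := by
  have key (i j : Fin 2) := (partialDeriv_congr (partialDeriv_congr h j) i).eq_of_nhds
  simp only [airyStress, key]

theorem isSymm_airyStress (u : (Fin 2 → ℝ) → ℝ) (y : Fin 2 → ℝ) : (airyStress u y).IsSymm := by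
  ext i j
  fin_cases i <;> fin_cases j <;> simp [airyStress]

theorem airyStress_add_const {u : (Fin 2 → ℝ) → ℝ} {a : Fin 2 → ℝ}
    (h : ∀ y, u (y + a) = u y) (y : Fin 2 → ℝ) :
    airyStress u (y + a) = airyStress u y := by
  have key (i j : Fin 2) := partialDeriv_add_const (partialDeriv_add_const h j) i y
  simp only [airyStress, key]

theorem continuous_airyStress_apply {u : (Fin 2 → ℝ) → ℝ} (hu : ContDiff ℝ (⊤ : ℕ∞) u)
    (i j : Fin 2) : Continuous fun y => airyStress u y i j := by
  have key (a b : Fin 2) :=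
    (contDiff_partialDeriv (contDiff_partialDeriv hu b) a).continuous
  fin_cases i <;> fin_cases j <;> simp [airyStress, key, (key 0 1).fun_neg]

theorem airyStress_zero (y : Fin 2 → ℝ) : airyStress (fun _ => 0) y = 0 := by
  have h (i : Fin 2) : partialDeriv i (fun _ => 0) = fun _ => 0 := by
    ext z; simp [partialDeriv]
  ext i j
  fin_cases i <;> fin_cases j <;> simp [airyStress, h]

theorem airyStress_half_sq_dist (a y : Fin 2 → ℝ) :
    airyStress (fun z => ((z 0 - a 0) ^ 2 + (z 1 - a 1) ^ 2) / 2) y = 1 := by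
  have h1 (i : Fin 2) : partialDeriv i (fun z => ((z 0 - a 0) ^ 2 + (z 1 - a 1) ^ 2) / 2)
      = fun z => z i - a i := by
    ext z
    have h (j : Fin 2) : HasFDerivAt (fun z : Fin 2 → ℝ => (z j - a j))
        (ContinuousLinearMap.proj (R := ℝ) (φ := fun _ : Fin 2 => ℝ) j) z :=
      (hasFDerivAt_apply j z).sub_const _
    have hd := (((h 0).pow 2).fun_add ((h 1).pow 2)).mul_const (2 : ℝ)⁻¹
    simp only [partialDeriv, div_eq_mul_inv, hd.fderiv]
    fin_cases i <;> simp
  have h2 (i j : Fin 2) : partialDeriv j (fun z => z i - a i) y = (Pi.single j 1 : Fin 2 → ℝ) i := by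
    rw [partialDeriv, ((hasFDerivAt_apply i y).sub_const _).fderiv]
    simp
  ext i j
  fin_cases i <;> fin_cases j <;> simp [airyStress, h1, h2]

theorem integral_mul_partialDeriv {f g : (Fin 2 → ℝ) → ℝ} (hf : ContDiff ℝ (⊤ : ℕ∞) f)
    (hg : ContDiff ℝ (⊤ : ℕ∞) g) (hgc : HasCompactSupport g) (i : Fin 2) :
    ∫ y, f y * partialDeriv i g y = -∫ y, partialDeriv i f y * g y := by
  have hf' := (contDiff_partialDeriv hf i).continuous
  have hg' := (contDiff_partialDeriv hg i).continuous
  exact integral_mul_fderiv_eq_neg_fderiv_mul_of_integrable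
    ((hf'.mul hg.continuous).integrable_of_hasCompactSupport hgc.mul_left)
    ((hf.continuous.mul hg').integrable_of_hasCompactSupport (hgc.partialDeriv i).mul_left)
    ((hf.continuous.mul hg.continuous).integrable_of_hasCompactSupport hgc.mul_left)
    (fun y _ => hf.differentiable (by simp) y) (fun y _ => hg.differentiable (by simp) y)

theorem integrable_mul_partialDeriv {f g : (Fin 2 → ℝ) → ℝ} (hf : ContDiff ℝ (⊤ : ℕ∞) f)
    (hg : ContDiff ℝ (⊤ : ℕ∞) g) (hgc : HasCompactSupport g) (i : Fin 2) :
    Integrable fun y => f y * partialDeriv i g y :=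
  (hf.continuous.mul (contDiff_partialDeriv hg i).continuous).integrable_of_hasCompactSupport
    (hgc.partialDeriv i).mul_left

/-- The rotated gradient of a smooth function is divergence-free. -/
theorem integral_partialDeriv_mul_comm {w f : (Fin 2 → ℝ) → ℝ} (hw : ContDiff ℝ (⊤ : ℕ∞) w)
    (hf : ContDiff ℝ (⊤ : ℕ∞) f) (hfc : HasCompactSupport f) (i j : Fin 2) :
    ∫ y, partialDeriv i w y * partialDeriv j f y
      = ∫ y, partialDeriv j w y * partialDeriv i f y := by
  rw [integral_mul_partialDeriv (contDiff_partialDeriv hw i) hf hfc,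
    integral_mul_partialDeriv (contDiff_partialDeriv hw j) hf hfc]
  simp only [partialDeriv_comm hw i j]

theorem integral_airyStress_mul_symmGrad {u : (Fin 2 → ℝ) → ℝ} (hu : ContDiff ℝ (⊤ : ℕ∞) u)
    {ψ : (Fin 2 → ℝ) → (Fin 2 → ℝ)} (hψ : ContDiff ℝ (⊤ : ℕ∞) ψ) (hψc : HasCompactSupport ψ) :
    ∫ y : Fin 2 → ℝ, ∑ i : Fin 2, ∑ j : Fin 2, airyStress u y i j *
      ((1 / 2) * ((fderiv ℝ ψ y (Pi.single j 1)) i + (fderiv ℝ ψ y (Pi.single i 1)) j)) = 0 := by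
  have hcomp (i : Fin 2) : ContDiff ℝ (⊤ : ℕ∞) fun y => ψ y i := contDiff_pi.1 hψ i
  have hsupp (i : Fin 2) : HasCompactSupport fun y => ψ y i :=
    hψc.comp_left (g := fun v : Fin 2 → ℝ => v i) rfl
  have hd (i j : Fin 2) (y : Fin 2 → ℝ) :
      fderiv ℝ ψ y (Pi.single j 1) i = partialDeriv j (fun z => ψ z i) y := by
    rw [partialDeriv, fderiv_apply (hψ.differentiable (by simp) y)]
    rfl
  have hu' (i : Fin 2) := contDiff_partialDeriv hu i
  have hu'' (i j : Fin 2) := contDiff_partialDeriv (hu' i) j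
  have hprod (a b i j : Fin 2) := integrable_mul_partialDeriv (hu'' a b) (hcomp i) (hsupp i) j
  have hsplit (y : Fin 2 → ℝ) : ∑ i : Fin 2, ∑ j : Fin 2, airyStress u y i j *
      ((1 / 2) * ((fderiv ℝ ψ y (Pi.single j 1)) i + (fderiv ℝ ψ y (Pi.single i 1)) j))
      = (partialDeriv 1 (partialDeriv 1 u) y * partialDeriv 0 (fun z => ψ z 0) y
          - partialDeriv 0 (partialDeriv 1 u) y * partialDeriv 1 (fun z => ψ z 0) y)
        + (partialDeriv 0 (partialDeriv 0 u) y * partialDeriv 1 (fun z => ψ z 1) y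
          - partialDeriv 1 (partialDeriv 0 u) y * partialDeriv 0 (fun z => ψ z 1) y) := by
    rw [partialDeriv_comm hu 1 0]
    simp [Fin.sum_univ_two, airyStress, hd]
    ring
  simp only [hsplit]
  have hsub (a b i j c d k l : Fin 2) : Integrable fun y =>
      partialDeriv b (partialDeriv a u) y * partialDeriv j (fun z => ψ z i) y
        - partialDeriv d (partialDeriv c u) y * partialDeriv l (fun z => ψ z k) y :=
    (hprod a b i j).sub (hprod c d k l)
  rw [integral_add (hsub _ _ _ _ _ _ _ _) (hsub _ _ _ _ _ _ _ _),
    integral_sub (hprod _ _ _ _) (hprod _ _ _ _), integral_sub (hprod _ _ _ _) (hprod _ _ _ _),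
    integral_partialDeriv_mul_comm (hu' 1) (hcomp 0) (hsupp 0) 1 0,
    integral_partialDeriv_mul_comm (hu' 0) (hcomp 1) (hsupp 1) 0 1]
  ring

theorem latticeRound_add_intCast (y : Fin 2 → ℝ) (k : Fin 2 → ℤ) :
    latticeRound (y + fun i => (k i : ℝ)) = latticeRound y + fun i => (k i : ℝ) := by
  ext i
  simp [latticeRound]

theorem norm_sub_latticeRound_le (y : Fin 2 → ℝ) : ‖y - latticeRound y‖ ≤ 1 / 2 :=
  (pi_norm_le_iff_of_nonneg (by norm_num)).2 fun i => abs_sub_round (y i)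

/-- Near a lattice point `k`, the periodization of a function supported in a sup-norm ball of
radius `ρ` is its translate by `k`. -/
theorem comp_sub_latticeRound_eq {v : (Fin 2 → ℝ) → ℝ} {ρ : ℝ}
    (hv : ∀ y, ρ ≤ ‖y‖ → v y = 0) {y : Fin 2 → ℝ} (k : Fin 2 → ℤ)
    (hy : ‖y - fun i => (k i : ℝ)‖ < 1 - ρ) :
    v (y - latticeRound y) = v (y - fun i => (k i : ℝ)) := by
  by_cases h : ∀ i, round (y i) = k i
  · rw [show latticeRound y = fun i => (k i : ℝ) from funext fun i => congrArg _ (h i)]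
  push Not at h
  obtain ⟨i, hi⟩ := h
  have hone : (1 : ℝ) ≤ |(round (y i) : ℝ) - k i| := by
    exact_mod_cast Int.one_le_abs (sub_ne_zero.2 hi)
  have h1 : |y i - k i| ≤ ‖y - fun i => (k i : ℝ)‖ := norm_le_pi_norm (y - fun i => (k i : ℝ)) i
  have h2 : |y i - round (y i)| ≤ ‖y - latticeRound y‖ := norm_le_pi_norm (y - latticeRound y) i
  have h3 : |(round (y i) : ℝ) - k i| ≤ |y i - round (y i)| + |y i - k i| := by
    rw [abs_sub_comm (y i) (round (y i))]
    exact abs_sub_le _ _ _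
  have h4 := abs_sub_round (y i)
  rw [hv _ (by linarith), hv _ (by linarith)]

theorem eventually_comp_sub_latticeRound_eq {v : (Fin 2 → ℝ) → ℝ} {ρ : ℝ} (hρ : ρ < 1 / 2)
    (hv : ∀ y, ρ ≤ ‖y‖ → v y = 0) {y : Fin 2 → ℝ} (k : Fin 2 → ℤ)
    (hy : ‖y - fun i => (k i : ℝ)‖ ≤ 1 / 2) :
    (fun z => v (z - latticeRound z)) =ᶠ[nhds y] fun z => v (z - fun i => (k i : ℝ)) := by
  have hc : Continuous fun z : Fin 2 → ℝ => ‖z - fun i => (k i : ℝ)‖ := by fun_prop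
  filter_upwards [hc.continuousAt.eventually_lt continuousAt_const
    (show ‖y - fun i => (k i : ℝ)‖ < 1 - ρ by linarith)] with z hz
  exact comp_sub_latticeRound_eq hv k hz

theorem contDiff_comp_sub_latticeRound {v : (Fin 2 → ℝ) → ℝ} {ρ : ℝ} (hρ : ρ < 1 / 2)
    (hv : ∀ y, ρ ≤ ‖y‖ → v y = 0) (hvs : ContDiff ℝ (⊤ : ℕ∞) v) :
    ContDiff ℝ (⊤ : ℕ∞) fun z => v (z - latticeRound z) := by
  refine contDiff_iff_contDiffAt.2 fun y => ?_
  have hs : ContDiff ℝ (⊤ : ℕ∞) fun z : Fin 2 → ℝ => v (z - latticeRound y) :=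
    hvs.comp (contDiff_id.sub contDiff_const)
  exact hs.contDiffAt.congr_of_eventuallyEq
    (eventually_comp_sub_latticeRound_eq hρ hv (fun i => round (y i)) (norm_sub_latticeRound_le y))

theorem comp_sub_latticeRound_add_intCast (v : (Fin 2 → ℝ) → ℝ) (y : Fin 2 → ℝ) (k : Fin 2 → ℤ) :
    v ((y + fun i => (k i : ℝ)) - latticeRound (y + fun i => (k i : ℝ)))
      = v (y - latticeRound y) := by
  rw [latticeRound_add_intCast, add_sub_add_right_eq_sub]

/-- A continuous function with integer periods is bounded. -/
theorem exists_abs_le_of_intPeriodic {f : (Fin 2 → ℝ) → ℝ} (hf : Continuous f)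
    (hper : ∀ y, ∀ k : Fin 2 → ℤ, f (y + fun i => (k i : ℝ)) = f y) : ∃ C, ∀ y, |f y| ≤ C := by
  obtain ⟨C, hC⟩ := (isCompact_closedBall (0 : Fin 2 → ℝ) (1 / 2)).exists_bound_of_continuousOn
    hf.continuousOn
  refine ⟨C, fun y => ?_⟩
  have h := hper (y - latticeRound y) fun i => round (y i)
  rw [show (y - latticeRound y + fun i => (round (y i) : ℝ)) = y from sub_add_cancel y _] at h
  rw [h]
  exact hC _ (mem_closedBall_zero_iff.2 (norm_sub_latticeRound_le y))

theorem contDiff_cutoffPotential (r : ℝ) : ContDiff ℝ (⊤ : ℕ∞) (cutoffPotential r) := by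
  have h (i : Fin 2) : ContDiff ℝ (⊤ : ℕ∞) fun y : Fin 2 → ℝ => y i := contDiff_apply ℝ ℝ i
  have hs := ((h 0).pow 2).add ((h 1).pow 2)
  exact (hs.div_const 2).mul
    (Real.smoothTransition.contDiff.comp ((contDiff_const.sub hs).div_const _))

theorem cutoffPotential_eq_zero {r : ℝ} {y : Fin 2 → ℝ} (h : 3 * r ^ 2 ≤ y 0 ^ 2 + y 1 ^ 2) :
    cutoffPotential r y = 0 := by
  rw [cutoffPotential, Real.smoothTransition.zero_of_nonpos, mul_zero]
  exact div_nonpos_of_nonpos_of_nonneg (by linarith) (sq_nonneg r)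

theorem cutoffPotential_eq_half_sq {r : ℝ} (hr : 0 < r) {y : Fin 2 → ℝ}
    (h : y 0 ^ 2 + y 1 ^ 2 ≤ 2 * r ^ 2) : cutoffPotential r y = (y 0 ^ 2 + y 1 ^ 2) / 2 := by
  rw [cutoffPotential, Real.smoothTransition.one_of_one_le, mul_one]
  rw [le_div_iff₀ (by positivity)]
  linarith

theorem cutoffPotential_eq_zero_of_le_norm {r : ℝ} (hr : 0 < r) {y : Fin 2 → ℝ}
    (h : 2 * r ≤ ‖y‖) : cutoffPotential r y = 0 := by
  apply cutoffPotential_eq_zero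
  by_contra! hlt
  have hy : ‖y‖ < 2 * r := by
    refine (pi_norm_lt_iff (by positivity)).2 fun i => abs_lt_of_sq_lt_sq ?_ (by positivity)
    fin_cases i <;> simp <;> nlinarith [sq_nonneg (y 0), sq_nonneg (y 1)]
  linarith

/-- for `0 < r < 1/4` there is an essentially bounded measurable
`ℤ²`-periodic map `φ : ℝ² → Sym_2` equal to the identity a.e. on the union of the closed
balls of radius `r` centered at integer points, vanishing a.e. outside the union of the
open balls of radius `2r` centered at integer points, and divergence-free in the sense
of distributions: `∫ φ · e(ψ) = 0` for every `ψ ∈ C_c^∞(ℝ²; ℝ²)`, where `e(ψ)` is the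
symmetrized gradient of `ψ` and `·` the Frobenius inner product. -/
theorem seppecher_counterexample_field (r : ℝ) (hr0 : 0 < r) (hr : r < 1 / 4) :
    ∃ φ : (Fin 2 → ℝ) → Matrix (Fin 2) (Fin 2) ℝ,
      Measurable φ ∧
      (∃ C : ℝ, ∀ᵐ y : Fin 2 → ℝ ∂volume, ∀ i j : Fin 2, |φ y i j| ≤ C) ∧
      (∀ y : Fin 2 → ℝ, (φ y).IsSymm) ∧
      (∀ y : Fin 2 → ℝ, ∀ k : Fin 2 → ℤ, φ (y + fun i => (k i : ℝ)) = φ y) ∧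
      (∀ᵐ y : Fin 2 → ℝ ∂volume,
        (∃ k : Fin 2 → ℤ, Real.sqrt (∑ i, (y i - (k i : ℝ)) ^ 2) ≤ r) → φ y = 1) ∧
      (∀ᵐ y : Fin 2 → ℝ ∂volume,
        (∀ k : Fin 2 → ℤ, ¬ Real.sqrt (∑ i, (y i - (k i : ℝ)) ^ 2) < 2 * r) → φ y = 0) ∧
      (∀ ψ : (Fin 2 → ℝ) → (Fin 2 → ℝ), ContDiff ℝ (⊤ : ℕ∞) ψ → HasCompactSupport ψ →
        ∫ y : Fin 2 → ℝ, ∑ i : Fin 2, ∑ j : Fin 2, φ y i j *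
          ((1 / 2) * ((fderiv ℝ ψ y (Pi.single j 1)) i + (fderiv ℝ ψ y (Pi.single i 1)) j))
          ∂volume = 0) := by
  have hv : ∀ y, 2 * r ≤ ‖y‖ → cutoffPotential r y = 0 :=
    fun y => cutoffPotential_eq_zero_of_le_norm hr0
  have hρ : 2 * r < 1 / 2 := by linarith
  let u : (Fin 2 → ℝ) → ℝ := fun z => cutoffPotential r (z - latticeRound z)
  have hu : ContDiff ℝ (⊤ : ℕ∞) u :=
    contDiff_comp_sub_latticeRound hρ hv (contDiff_cutoffPotential r)
  have hper (y : Fin 2 → ℝ) (k : Fin 2 → ℤ) :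
      airyStress u (y + fun i => (k i : ℝ)) = airyStress u y :=
    airyStress_add_const (fun z => comp_sub_latticeRound_add_intCast (cutoffPotential r) z k) y
  have hsq (k : Fin 2 → ℤ) :
      Continuous fun z : Fin 2 → ℝ => (z 0 - (k 0 : ℝ)) ^ 2 + (z 1 - (k 1 : ℝ)) ^ 2 := by
    fun_prop
  refine ⟨airyStress u, ?_, ?_, isSymm_airyStress u, hper, ?_, ?_, fun ψ hψ hψc =>
    integral_airyStress_mul_symmGrad hu hψ hψc⟩
  · exact measurable_pi_lambda _ fun i => measurable_pi_lambda _ fun j =>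
      (continuous_airyStress_apply hu i j).measurable
  · choose C hC using fun i j : Fin 2 => exists_abs_le_of_intPeriodic
      (continuous_airyStress_apply hu i j) fun y k => by rw [hper]
    refine ⟨∑ i, ∑ j, |C i j|, Filter.Eventually.of_forall fun y i j => ?_⟩
    calc |airyStress u y i j| ≤ |C i j| := (hC i j y).trans (le_abs_self _)
      _ ≤ ∑ j, |C i j| :=
        Finset.single_le_sum (f := fun j => |C i j|) (fun _ _ => abs_nonneg _) (Finset.mem_univ j)
      _ ≤ ∑ i, ∑ j, |C i j| :=
        Finset.single_le_sum (f := fun i => ∑ j, |C i j|)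
          (fun _ _ => Finset.sum_nonneg fun _ _ => abs_nonneg _) (Finset.mem_univ i)
  · refine Filter.Eventually.of_forall fun y ⟨k, hk⟩ => ?_
    rw [Real.sqrt_le_left hr0.le, Fin.sum_univ_two] at hk
    have hnorm : ‖y - fun i => (k i : ℝ)‖ ≤ 1 / 2 := by
      refine (pi_norm_le_iff_of_nonneg (by norm_num)).2 fun i => ?_
      refine (abs_le_of_sq_le_sq (b := r) ?_ hr0.le).trans (by linarith)
      fin_cases i <;> simp <;> nlinarith [sq_nonneg (y 0 - k 0), sq_nonneg (y 1 - k 1)]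
    have hev : u =ᶠ[nhds y] fun z => ((z 0 - (k 0 : ℝ)) ^ 2 + (z 1 - (k 1 : ℝ)) ^ 2) / 2 := by
      filter_upwards [eventually_comp_sub_latticeRound_eq hρ hv k hnorm,
        (hsq k).continuousAt.eventually_lt continuousAt_const
          (show _ < 2 * r ^ 2 by nlinarith)] with z hz hlt
      exact hz.trans (cutoffPotential_eq_half_sq hr0 hlt.le)
    rw [airyStress_congr hev]
    exact airyStress_half_sq_dist (fun i => (k i : ℝ)) y
  · refine Filter.Eventually.of_forall fun y hy => ?_
    have hk := hy fun i => round (y i)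
    rw [Real.sqrt_lt' (by positivity), Fin.sum_univ_two, not_lt] at hk
    have hev : u =ᶠ[nhds y] fun _ => 0 := by
      filter_upwards [eventually_comp_sub_latticeRound_eq hρ hv (fun i => round (y i))
          (norm_sub_latticeRound_le y),
        continuousAt_const.eventually_lt (hsq fun i => round (y i)).continuousAt
          (show 3 * r ^ 2 < _ by nlinarith)] with z hz hlt
      exact hz.trans (cutoffPotential_eq_zero hlt.le)
    rw [airyStress_congr hev, airyStress_zero]
end
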